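/- arXiv:2203.11677 — 5 statements merged into one kernel-verified Lean document; each statement's English description precedes it below -/
import Mathlib

section
/- Let Q_{k+1} = T_AL Q_k be the Advantage Learning iterates starting from any Q_0 : S × A → ℝ, let V_k = V_{Q_k}, let π* be an optimal deterministic policy, and let Δ_k^{π*}(s) = V_k(s) − Q_k(s, π*(s)). Let π_{K+1} be a greedy policy with respect to V_K, i.e. π_{K+1}(s) ∈ argmax_a [r(s,a) + γ Σ_{s'} P(s'|s,a) V_K(s')]. If V_max ≥ 0 satisfies ‖V*‖_∞ ≤ V_max and ‖V_0‖_∞ ≤ V_max, then ‖V* − V^{π_{K+1}}‖_∞ ≤ (2γ/(1−γ)) · [ 2 γ^K V_max + α Σ_{k=0}^{K−1} γ^{K−k−1} ‖Δ_k^{π*}‖_∞ ]. -/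
open Filter Topology Finset

/-- Value function induced by a Q-function: `V_Q(s) = max_a Q(s,a)`. -/
noncomputable def Vof {S A : Type*} [Fintype A] [Nonempty A]
    (Q : S → A → ℝ) (s : S) : ℝ := ⨆ a, Q s a

/-- Bellman optimality operator `(T Q)(s,a) = r(s,a) + γ Σ_{s'} P(s'|s,a) V_Q(s')`. -/
noncomputable def bellmanOp {S A : Type*} [Fintype S] [Fintype A] [Nonempty A]
    (P : S → A → S → ℝ) (r : S → A → ℝ) (γ : ℝ)
    (Q : S → A → ℝ) : S → A → ℝ :=
  fun s a => r s a + γ * ∑ s', P s a s' * Vof Q s'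

/-- Advantage Learning operator `(T_AL Q)(s,a) = (T Q)(s,a) - α (V_Q(s) - Q(s,a))`. -/
noncomputable def alOp {S A : Type*} [Fintype S] [Fintype A] [Nonempty A]
    (P : S → A → S → ℝ) (r : S → A → ℝ) (γ α : ℝ)
    (Q : S → A → ℝ) : S → A → ℝ :=
  fun s a => bellmanOp P r γ Q s a - α * (Vof Q s - Q s a)

/-- Clipped Advantage Learning operator. -/
noncomputable def clipOp {S A : Type*} [Fintype S] [Fintype A] [Nonempty A]
    (P : S → A → S → ℝ) (r : S → A → ℝ) (γ α c Ql : ℝ)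
    (Q : S → A → ℝ) : S → A → ℝ :=
  fun s a => if Q s a - Ql ≥ c * (Vof Q s - Ql)
    then alOp P r γ α Q s a else bellmanOp P r γ Q s a

/-- Sup norm over a finite nonempty domain. -/
noncomputable def supNorm {S : Type*} [Fintype S] [Nonempty S] (f : S → ℝ) : ℝ :=
  ⨆ s, |f s|

theorem le_supNorm_aux {S : Type*} [Fintype S] [Nonempty S] (f : S → ℝ) (s : S) :
    |f s| ≤ supNorm f :=
  le_ciSup (f := fun s => |f s|) (Set.finite_range _).bddAbove s

theorem le_Vof_aux {S A : Type*} [Fintype A] [Nonempty A] (Q : S → A → ℝ) (s : S) (a : A) :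
    Q s a ≤ Vof Q s :=
  le_ciSup (f := fun a => Q s a) (Set.finite_range _).bddAbove a

theorem avg_aux {S : Type*} [Fintype S] (p : S → ℝ) (h0 : ∀ s, 0 ≤ p s) (h1 : ∑ s, p s = 1)
    (f g : S → ℝ) (c : ℝ) (h : ∀ s, f s - g s ≤ c) :
    ∑ s, p s * f s - ∑ s, p s * g s ≤ c := by
  rw [← Finset.sum_sub_distrib]
  calc ∑ s, (p s * f s - p s * g s) ≤ ∑ s, p s * c := by
        apply Finset.sum_le_sum
        intro s _
        have := mul_le_mul_of_nonneg_left (h s) (h0 s)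
        linarith
    _ = c := by rw [← Finset.sum_mul, h1, one_mul]

theorem stmt_0
    {S A : Type*} [Fintype S] [Nonempty S] [Fintype A] [Nonempty A]
    (P : S → A → S → ℝ) (hP0 : ∀ s a s', 0 ≤ P s a s')
    (hP1 : ∀ s a, ∑ s', P s a s' = 1)
    (r : S → A → ℝ) (γ : ℝ) (hγ0 : 0 ≤ γ) (hγ1 : γ < 1)
    (Qstar : S → A → ℝ) (hQstar : bellmanOp P r γ Qstar = Qstar)
    (α : ℝ) (hα0 : 0 ≤ α) (hα1 : α < 1)
    (πstar : S → A) (hπstar : ∀ s, Qstar s (πstar s) = Vof Qstar s)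
    (Qseq : ℕ → S → A → ℝ)
    (hQseq : ∀ k, Qseq (k + 1) = alOp P r γ α (Qseq k))
    (K : ℕ)
    (π : S → A)
    (hπ : ∀ s a,
      r s a + γ * ∑ s', P s a s' * Vof (Qseq K) s' ≤
      r s (π s) + γ * ∑ s', P s (π s) s' * Vof (Qseq K) s')
    (Vπ : S → ℝ)
    (hVπ : ∀ s, Vπ s = r s (π s) + γ * ∑ s', P s (π s) s' * Vπ s')
    (Vmax : ℝ) (hVmax0 : 0 ≤ Vmax)
    (hVstarB : supNorm (Vof Qstar) ≤ Vmax)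
    (hV0B : supNorm (Vof (Qseq 0)) ≤ Vmax) :
    supNorm (fun s => Vof Qstar s - Vπ s) ≤
      2 * γ / (1 - γ) *
        (2 * γ ^ K * Vmax +
          α * ∑ k ∈ Finset.range K,
            γ ^ (K - k - 1) *
              supNorm (fun s => Vof (Qseq k) s - Qseq k s (πstar s))) := by
  have key : ∀ (f g : S → ℝ) (c : ℝ), (∀ s, f s - g s ≤ c) → ∀ s a,
      γ * ∑ s', P s a s' * f s' - γ * ∑ s', P s a s' * g s' ≤ γ * c := by
    intro f g c h s a
    have := mul_le_mul_of_nonneg_left (avg_aux (P s a) (hP0 s a) (hP1 s a) f g c h) hγ0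
    linarith
  have hQ : ∀ s a, Qstar s a = r s a + γ * ∑ s', P s a s' * Vof Qstar s' := by
    intro s a
    exact (congrFun (congrFun hQstar s) a).symm
  have hV : ∀ s a, r s a + γ * ∑ s', P s a s' * Vof Qstar s' ≤ Vof Qstar s := by
    intro s a
    rw [← hQ]
    exact le_Vof_aux _ _ _
  have hVs : ∀ s, Vof Qstar s
      = r s (πstar s) + γ * ∑ s', P s (πstar s) s' * Vof Qstar s' := by
    intro s
    rw [← hQ, hπstar]
  have main : ∀ n : ℕ, ∀ s, |Vof Qstar s - Vof (Qseq n) s| ≤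
      2 * γ ^ n * Vmax + α * ∑ k ∈ Finset.range n, γ ^ (n - k - 1) *
              supNorm (fun s => Vof (Qseq k) s - Qseq k s (πstar s)) := by
    intro n
    induction n with
    | zero =>
      intro s
      have h1 := (le_supNorm_aux _ s).trans hVstarB
      have h2 := (le_supNorm_aux _ s).trans hV0B
      rw [abs_le] at *
      simp only [pow_zero, Finset.range_zero, Finset.sum_empty]
      constructor <;> linarith [h1.1, h1.2, h2.1, h2.2]
    | succ n ih =>
      intro s
      have hsum : ∑ k ∈ Finset.range (n + 1), γ ^ (n + 1 - k - 1) *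
              supNorm (fun s => Vof (Qseq k) s - Qseq k s (πstar s))
          = γ * (∑ k ∈ Finset.range n, γ ^ (n - k - 1) *
              supNorm (fun s => Vof (Qseq k) s - Qseq k s (πstar s)))
            + supNorm (fun s => Vof (Qseq n) s - Qseq n s (πstar s)) := by
        rw [Finset.sum_range_succ, Finset.mul_sum]
        congr 1
        · apply Finset.sum_congr rfl
          intro k hk
          have hk := Finset.mem_range.mp hk
          have : n + 1 - k - 1 = (n - k - 1) + 1 := by omega
          rw [this, pow_succ]
          ring
        · simp
      rw [hsum, pow_succ]
      set e := 2 * γ ^ n * Vmax + α * ∑ k ∈ Finset.range n, γ ^ (n - k - 1) *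
              supNorm (fun s => Vof (Qseq k) s - Qseq k s (πstar s)) with he
      set d := supNorm (fun s => Vof (Qseq n) s - Qseq n s (πstar s)) with hd
      have hdn : |Vof (Qseq n) s - Qseq n s (πstar s)| ≤ d :=
        le_supNorm_aux (fun s => Vof (Qseq n) s - Qseq n s (πstar s)) s
      have hd0 : 0 ≤ d := (abs_nonneg _).trans hdn
      have hαd : 0 ≤ α * d := mul_nonneg hα0 hd0
      have goal' : |Vof Qstar s - Vof (Qseq (n + 1)) s| ≤ γ * e + α * d := by
        have hexp : ∀ a, Qseq (n + 1) s a = r s a + γ * ∑ s', P s a s' * Vof (Qseq n) s'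
            - α * (Vof (Qseq n) s - Qseq n s a) := by
          intro a
          rw [hQseq]
          rfl
        have up : Vof (Qseq (n + 1)) s ≤ Vof Qstar s + γ * e := by
          apply ciSup_le
          intro a
          have h1 := key (Vof (Qseq n)) (Vof Qstar) e
            (fun s => by linarith [(abs_le.mp (ih s)).1]) s a
          have h2 := mul_nonneg hα0 (sub_nonneg.mpr (le_Vof_aux (Qseq n) s a))
          linarith [hexp a, hV s a]
        have lo : Vof Qstar s - Vof (Qseq (n + 1)) s ≤ γ * e + α * d := by
          have h1 := key (Vof Qstar) (Vof (Qseq n)) e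
            (fun s => (abs_le.mp (ih s)).2) s (πstar s)
          have h2 := mul_le_mul_of_nonneg_left ((le_abs_self _).trans hdn) hα0
          have h3 := le_Vof_aux (Qseq (n + 1)) s (πstar s)
          linarith [hexp (πstar s), hVs s]
        rw [abs_le]
        constructor <;> linarith
      refine goal'.trans (le_of_eq ?_)
      rw [he]
      ring
  have hK := main K
  set e := 2 * γ ^ K * Vmax + α * ∑ k ∈ Finset.range K, γ ^ (K - k - 1) *
              supNorm (fun s => Vof (Qseq k) s - Qseq k s (πstar s)) with he
  set D := supNorm (fun s => Vof Qstar s - Vπ s) with hD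
  have hDs : ∀ s, |Vof Qstar s - Vπ s| ≤ D := fun s =>
    le_supNorm_aux (fun s => Vof Qstar s - Vπ s) s
  have he0 : 0 ≤ e := (abs_nonneg _).trans (hK (Classical.arbitrary S))
  have hfin : D ≤ 2 * γ * e + γ * D := by
    apply ciSup_le
    intro s
    have hge : 0 ≤ γ * e := mul_nonneg hγ0 he0
    have h1 := key (Vof Qstar) (Vof (Qseq K)) e (fun s => (abs_le.mp (hK s)).2) s (πstar s)
    have h2 := key (Vof (Qseq K)) (Vof Qstar) e
      (fun s => by linarith [(abs_le.mp (hK s)).1]) s (π s)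
    have h3 := key (Vof Qstar) Vπ D (fun s => (abs_le.mp (hDs s)).2) s (π s)
    have h4 := key Vπ (Vof Qstar) D (fun s => by linarith [(abs_le.mp (hDs s)).1]) s (π s)
    have h5 := hπ s (πstar s)
    rw [abs_le]
    constructor
    · linarith [hV s (π s), hVπ s]
    · linarith [hVs s, hVπ s]
  have h1γ : 0 < 1 - γ := by linarith
  rw [div_mul_eq_mul_div, le_div_iff₀ h1γ]
  linarith
end

section
/- Let Q_{k+1} = T_AL Q_k be the Advantage Learning iterates from any Q_0 : S × A → ℝ, V_k = V_{Q_k}, π* an optimal deterministic policy, and Δ_k^{π*}(s) = V_k(s) − Q_k(s, π*(s)). Then for every K ≥ 1: ‖V* − V_K‖_∞ ≤ γ^K ‖V* − V_0‖_∞ + α Σ_{k=0}^{K−1} γ^{K−k−1} ‖Δ_k^{π*}‖_∞. -/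
open Filter Topology Finset

theorem bellman_diff_aux {S A : Type*} [Fintype S] [Nonempty S] [Fintype A] [Nonempty A]
    (P : S → A → S → ℝ) (hP0 : ∀ s a s', 0 ≤ P s a s')
    (hP1 : ∀ s a, ∑ s', P s a s' = 1)
    (r : S → A → ℝ) (γ : ℝ) (hγ0 : 0 ≤ γ) (Q Q' : S → A → ℝ) (s : S) (a : A) :
    |bellmanOp P r γ Q s a - bellmanOp P r γ Q' s a| ≤
      γ * supNorm (fun s => Vof Q s - Vof Q' s) := by
  have h1 : bellmanOp P r γ Q s a - bellmanOp P r γ Q' s a =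
      γ * ∑ s', P s a s' * (Vof Q s' - Vof Q' s') := by
    simp only [bellmanOp, mul_sub, Finset.sum_sub_distrib]
    ring
  rw [h1, abs_mul, abs_of_nonneg hγ0]
  refine mul_le_mul_of_nonneg_left ?_ hγ0
  calc |∑ s', P s a s' * (Vof Q s' - Vof Q' s')|
      ≤ ∑ s', |P s a s' * (Vof Q s' - Vof Q' s')| := Finset.abs_sum_le_sum_abs _ _
    _ ≤ ∑ s', P s a s' * supNorm (fun s => Vof Q s - Vof Q' s) := by
        refine Finset.sum_le_sum fun s' _ => ?_
        rw [abs_mul, abs_of_nonneg (hP0 s a s')]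
        exact mul_le_mul_of_nonneg_left
          (le_supNorm_aux (fun s => Vof Q s - Vof Q' s) s') (hP0 s a s')
    _ = _ := by rw [← Finset.sum_mul, hP1, one_mul]

theorem stmt_2
    {S A : Type*} [Fintype S] [Nonempty S] [Fintype A] [Nonempty A]
    (P : S → A → S → ℝ) (hP0 : ∀ s a s', 0 ≤ P s a s')
    (hP1 : ∀ s a, ∑ s', P s a s' = 1)
    (r : S → A → ℝ) (γ : ℝ) (hγ0 : 0 ≤ γ) (hγ1 : γ < 1)
    (Qstar : S → A → ℝ) (hQstar : bellmanOp P r γ Qstar = Qstar)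
    (α : ℝ) (hα0 : 0 ≤ α) (hα1 : α < 1)
    (πstar : S → A) (hπstar : ∀ s, Qstar s (πstar s) = Vof Qstar s)
    (Qseq : ℕ → S → A → ℝ)
    (hQseq : ∀ k, Qseq (k + 1) = alOp P r γ α (Qseq k))
 :
    ∀ K : ℕ, 1 ≤ K →
      supNorm (fun s => Vof Qstar s - Vof (Qseq K) s) ≤
        γ ^ K * supNorm (fun s => Vof Qstar s - Vof (Qseq 0) s) +
          α * ∑ k ∈ Finset.range K,
            γ ^ (K - k - 1) *
              supNorm (fun s => Vof (Qseq k) s - Qseq k s (πstar s)) := by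
  have step : ∀ k, supNorm (fun s => Vof Qstar s - Vof (Qseq (k + 1)) s) ≤
      γ * supNorm (fun s => Vof Qstar s - Vof (Qseq k) s) +
        α * supNorm (fun s => Vof (Qseq k) s - Qseq k s (πstar s)) := by
    intro k
    refine ciSup_le fun s => ?_
    have hd : ∀ s, |Vof (Qseq k) s - Qseq k s (πstar s)| ≤ _ :=
      le_supNorm_aux (fun s => Vof (Qseq k) s - Qseq k s (πstar s))
    have hb := bellman_diff_aux P hP0 hP1 r γ hγ0 Qstar (Qseq k) s
    rw [hQstar] at hb
    have hq : ∀ a, Qseq (k + 1) s a =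
        bellmanOp P r γ (Qseq k) s a - α * (Vof (Qseq k) s - Qseq k s a) := by
      intro a
      rw [hQseq]
      rfl
    have hdn := mul_nonneg hα0 ((abs_nonneg _).trans (hd s))
    rw [abs_le]
    constructor
    · have hu : Vof (Qseq (k + 1)) s ≤ Vof Qstar s +
          γ * supNorm (fun s => Vof Qstar s - Vof (Qseq k) s) := by
        refine ciSup_le fun a => ?_
        have h1 := (abs_le.mp (hb a)).1
        have h2 := le_Vof_aux Qstar s a
        have h3 := mul_nonneg hα0 (sub_nonneg.mpr (le_Vof_aux (Qseq k) s a))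
        rw [hq]
        linarith
      linarith
    · have h1 := (abs_le.mp (hb (πstar s))).2
      have h2 := le_Vof_aux (Qseq (k + 1)) s (πstar s)
      have h3 := mul_le_mul_of_nonneg_left ((le_abs_self _).trans (hd s)) hα0
      rw [hq] at h2
      rw [hπstar] at h1
      linarith
  intro K _
  clear * - step hγ0
  induction K with
  | zero => simp
  | succ n ih =>
    have h := mul_le_mul_of_nonneg_left ih hγ0
    refine (step n).trans ?_
    rw [Finset.sum_range_succ]
    have hs : ∑ k ∈ Finset.range n, γ ^ (n + 1 - k - 1) *
          supNorm (fun s => Vof (Qseq k) s - Qseq k s (πstar s)) =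
        γ * ∑ k ∈ Finset.range n, γ ^ (n - k - 1) *
          supNorm (fun s => Vof (Qseq k) s - Qseq k s (πstar s)) := by
      rw [Finset.mul_sum]
      refine Finset.sum_congr rfl fun k hk => ?_
      have hk' := Finset.mem_range.mp hk
      rw [show n + 1 - k - 1 = (n - k - 1) + 1 by omega, pow_succ]
      ring
    rw [hs, show n + 1 - n - 1 = 0 by omega, pow_succ]
    linarith
end

section
/- Let V : S → ℝ be arbitrary and let π : S → A be any greedy policy with respect to V, i.e. π(s) ∈ argmax_a [r(s,a) + γ Σ_{s'} P(s'|s,a) V(s')] for every s. Then ‖V* − V^π‖_∞ ≤ (2γ/(1−γ)) ‖V* − V‖_∞. -/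
open Filter Topology Finset

theorem stmt_3
    {S A : Type*} [Fintype S] [Nonempty S] [Fintype A] [Nonempty A]
    (P : S → A → S → ℝ) (hP0 : ∀ s a s', 0 ≤ P s a s')
    (hP1 : ∀ s a, ∑ s', P s a s' = 1)
    (r : S → A → ℝ) (γ : ℝ) (hγ0 : 0 ≤ γ) (hγ1 : γ < 1)
    (Qstar : S → A → ℝ) (hQstar : bellmanOp P r γ Qstar = Qstar)
    (V : S → ℝ) (π : S → A)
    (hπ : ∀ s a,
      r s a + γ * ∑ s', P s a s' * V s' ≤
      r s (π s) + γ * ∑ s', P s (π s) s' * V s')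
    (Vπ : S → ℝ)
    (hVπ : ∀ s, Vπ s = r s (π s) + γ * ∑ s', P s (π s) s' * Vπ s') :
    supNorm (fun s => Vof Qstar s - Vπ s) ≤
      2 * γ / (1 - γ) * supNorm (fun s => Vof Qstar s - V s) := by
  have key : ∀ (f g : S → ℝ) (s : S) (a : A),
      γ * ∑ s', P s a s' * f s' ≤
        γ * ∑ s', P s a s' * g s' + γ * supNorm (fun s => f s - g s) := by
    intro f g s a
    rw [← mul_add]
    refine mul_le_mul_of_nonneg_left ?_ hγ0
    have h1 : supNorm (fun s => f s - g s)
        = ∑ s', P s a s' * supNorm (fun s => f s - g s) := by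
      rw [← Finset.sum_mul, hP1, one_mul]
    rw [h1, ← Finset.sum_add_distrib]
    refine Finset.sum_le_sum fun s' _ => ?_
    rw [← mul_add]
    refine mul_le_mul_of_nonneg_left ?_ (hP0 s a s')
    have h2 : |f s' - g s'| ≤ supNorm (fun s => f s - g s) :=
      le_ciSup (f := fun s => |f s - g s|) (Set.finite_range _).bddAbove s'
    linarith [le_abs_self (f s' - g s')]
  have symm : ∀ f g : S → ℝ,
      supNorm (fun s => f s - g s) = supNorm (fun s => g s - f s) := by
    intro f g
    unfold supNorm
    simp only [abs_sub_comm]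
  have hQ : ∀ s a, Qstar s a = r s a + γ * ∑ s', P s a s' * Vof Qstar s' :=
    fun s a => (congrFun (congrFun hQstar s) a).symm
  have main : supNorm (fun s => Vof Qstar s - Vπ s) ≤
      γ * supNorm (fun s => Vof Qstar s - Vπ s)
        + 2 * γ * supNorm (fun s => Vof Qstar s - V s) := by
    have hE : 0 ≤ γ * supNorm (fun s => Vof Qstar s - V s) :=
      mul_nonneg hγ0 (Real.iSup_nonneg fun s => abs_nonneg _)
    refine ciSup_le fun s => abs_le.mpr ⟨?_, ?_⟩
    · have h1 : Qstar s (π s) ≤ Vof Qstar s :=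
        le_ciSup (f := Qstar s) (Set.finite_range _).bddAbove (π s)
      have h2 := key Vπ (Vof Qstar) s (π s)
      rw [symm] at h2
      linarith [hQ s (π s), hVπ s]
    · have h1 : Vof Qstar s ≤ Vπ s + (γ * supNorm (fun s => Vof Qstar s - Vπ s)
        + 2 * γ * supNorm (fun s => Vof Qstar s - V s)) := by
        refine ciSup_le fun a => ?_
        have h2 := key (Vof Qstar) V s a
        have h3 := key V (Vof Qstar) s (π s)
        rw [symm] at h3
        have h4 := key (Vof Qstar) Vπ s (π s)
        linarith [hQ s a, hVπ s, hπ s a]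
      linarith
  rw [div_mul_eq_mul_div, le_div_iff₀ (by linarith)]
  linarith
end

section
/- Let T' : (S × A → ℝ) → (S × A → ℝ) be any operator satisfying, for all Q : S × A → ℝ and all (s,a): (T Q)(s,a) − α (V_Q(s) − Q(s,a)) ≤ (T' Q)(s,a) ≤ (T Q)(s,a), where α ∈ [0,1). Then for every Q_0 : S × A → ℝ, defining Q_{k+1} = T' Q_k, and for every state s and action a with Q*(s,a) < V*(s), one has limsup_{k→∞} Q_k(s,a) < V*(s). -/
open Filter Topology Finset

theorem Vof_le_aux {S A : Type*} [Fintype A] [Nonempty A] (Q : S → A → ℝ) (s : S) (c : ℝ)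
    (h : ∀ a, Q s a ≤ c) : Vof Q s ≤ c := ciSup_le h

theorem Vof_att_aux {S A : Type*} [Fintype A] [Nonempty A] (Q : S → A → ℝ) (s : S) :
    ∃ a, Q s a = Vof Q s := exists_eq_ciSup_of_finite (f := fun a => Q s a)

theorem stmt_7
    {S A : Type*} [Fintype S] [Nonempty S] [Fintype A] [Nonempty A]
    (P : S → A → S → ℝ) (hP0 : ∀ s a s', 0 ≤ P s a s')
    (hP1 : ∀ s a, ∑ s', P s a s' = 1)
    (r : S → A → ℝ) (γ : ℝ) (hγ0 : 0 ≤ γ) (hγ1 : γ < 1)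
    (Qstar : S → A → ℝ) (hQstar : bellmanOp P r γ Qstar = Qstar)
    (α : ℝ) (hα0 : 0 ≤ α) (hα1 : α < 1)
    (T' : (S → A → ℝ) → (S → A → ℝ))
    (hT' : ∀ Q s a,
      bellmanOp P r γ Q s a - α * (Vof Q s - Q s a) ≤ T' Q s a ∧
      T' Q s a ≤ bellmanOp P r γ Q s a)
    (Qseq : ℕ → S → A → ℝ)
    (hQseq : ∀ k, Qseq (k + 1) = T' (Qseq k))
 :
    ∀ (s : S) (a : A), Qstar s a < Vof Qstar s →
      Filter.limsup (fun k => Qseq k s a) atTop < Vof Qstar s := by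
  intro s a hsa
  obtain ⟨B, hB⟩ : ∃ B : ℝ, ∀ s a, |r s a| + |Qseq 0 s a| + |Qstar s a| ≤ B := by
    obtain ⟨B, hB⟩ := (Set.finite_range (fun p : S × A =>
      |r p.1 p.2| + |Qseq 0 p.1 p.2| + |Qstar p.1 p.2|)).bddAbove
    exact ⟨B, fun s a => hB ⟨(s, a), rfl⟩⟩
  have hr : ∀ s a, -B ≤ r s a := fun s a => by
    linarith [hB s a, neg_abs_le (r s a), abs_nonneg (Qseq 0 s a), abs_nonneg (Qstar s a)]
  have h0 : ∀ s a, -B ≤ Qseq 0 s a := fun s a => by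
    linarith [hB s a, neg_abs_le (Qseq 0 s a), abs_nonneg (r s a), abs_nonneg (Qstar s a)]
  have hs : ∀ s a, Qstar s a ≤ B := fun s a => by
    linarith [hB s a, le_abs_self (Qstar s a), abs_nonneg (r s a), abs_nonneg (Qseq 0 s a)]
  have h0s : ∀ s a, Qseq 0 s a ≤ Qstar s a + B := fun s a => by
    linarith [hB s a, neg_abs_le (Qstar s a), le_abs_self (Qseq 0 s a), abs_nonneg (r s a)]
  have hB0 : 0 ≤ B := by
    linarith [hB s a, abs_nonneg (Qstar s a), abs_nonneg (r s a), abs_nonneg (Qseq 0 s a)]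
  -- upper bound
  have hup : ∀ k s a, Qseq k s a ≤ Qstar s a + γ ^ k * B := by
    intro k
    induction k with
    | zero => intro s a; simpa using h0s s a
    | succ k ih =>
      intro s a
      have hV : ∀ s', Vof (Qseq k) s' ≤ Vof Qstar s' + γ ^ k * B := fun s' =>
        Vof_le_aux _ _ _ fun a => (ih s' a).trans (by linarith [le_Vof_aux Qstar s' a])
      have h1 : ∑ s', P s a s' * Vof (Qseq k) s' ≤
          ∑ s', P s a s' * Vof Qstar s' + γ ^ k * B := by
        calc _ ≤ ∑ s', P s a s' * (Vof Qstar s' + γ ^ k * B) :=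
              Finset.sum_le_sum fun s' _ => mul_le_mul_of_nonneg_left (hV s') (hP0 s a s')
          _ = _ := by simp only [mul_add, Finset.sum_add_distrib, ← Finset.sum_mul, hP1, one_mul]
      have h2 := (hT' (Qseq k) s a).2
      have h3 := congrFun (congrFun hQstar s) a
      rw [hQseq]
      simp only [bellmanOp] at h2 h3
      have h4 := mul_le_mul_of_nonneg_left h1 hγ0
      rw [pow_succ]
      nlinarith
  have hg : 0 < 1 - γ := by linarith
  have hal : 0 < 1 - α := by linarith
  obtain ⟨M, hM⟩ : ∃ M, M * (1 - γ) = B := ⟨B / (1 - γ), by field_simp⟩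
  have hM0 : 0 ≤ M := by
    by_contra h
    push Not at h
    nlinarith
  have hBM : B ≤ M := by nlinarith
  have hPV : ∀ k, (∀ s, -M ≤ Vof (Qseq k) s) → ∀ s a, -M ≤ bellmanOp P r γ (Qseq k) s a := by
    intro k hk s a
    have h1 : -M ≤ ∑ s', P s a s' * Vof (Qseq k) s' := by
      calc -M = ∑ s', P s a s' * (-M) := by rw [← Finset.sum_mul, hP1, one_mul]
        _ ≤ _ := Finset.sum_le_sum fun s' _ => mul_le_mul_of_nonneg_left (hk s') (hP0 s a s')
    have h4 := mul_le_mul_of_nonneg_left h1 hγ0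
    simp only [bellmanOp]
    nlinarith [hr s a]
  have hVlow : ∀ k s, -M ≤ Vof (Qseq k) s := by
    intro k
    induction k with
    | zero => intro s; linarith [h0 s a, le_Vof_aux (Qseq 0) s a]
    | succ k ih =>
      intro s
      obtain ⟨b, hb⟩ := Vof_att_aux (Qseq k) s
      have h2 := (hT' (Qseq k) s b).1
      rw [hb, ← hQseq] at h2
      have := hPV k ih s b
      linarith [le_Vof_aux (Qseq (k+1)) s b]
  have hVup : ∀ k s, Vof (Qseq k) s ≤ 2 * B := by
    intro k s
    refine Vof_le_aux _ _ _ fun a => ?_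
    have : γ ^ k ≤ 1 := pow_le_one₀ hγ0 hγ1.le
    nlinarith [hup k s a, hs s a]
  obtain ⟨L, hL⟩ : ∃ L, L * (1 - α) = M + α * (2 * B) :=
    ⟨(M + α * (2 * B)) / (1 - α), by field_simp⟩
  have hαB : 0 ≤ α * B := mul_nonneg hα0 hB0
  have hL0 : 0 ≤ L := by
    by_contra h
    push Not at h
    nlinarith
  have hBL : B ≤ L := by nlinarith [mul_nonneg hα0 hL0]
  have hlow : ∀ k s a, -L ≤ Qseq k s a := by
    intro k
    induction k with
    | zero => intro s a; linarith [h0 s a]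
    | succ k ih =>
      intro s a
      have h2 := (hT' (Qseq k) s a).1
      rw [hQseq]
      have h3 := hPV k (hVlow k) s a
      have h4 := mul_le_mul_of_nonneg_left (hVup k s) hα0
      have h5 := mul_le_mul_of_nonneg_left (ih s a) hα0
      nlinarith
  have hlim : Tendsto (fun k : ℕ => Qstar s a + γ ^ k * B) atTop (𝓝 (Qstar s a)) := by
    simpa using ((tendsto_pow_atTop_nhds_zero_of_lt_one hγ0 hγ1).mul_const B).const_add (Qstar s a)
  have hle : Filter.limsup (fun k => Qseq k s a) atTop ≤ (Qstar s a + Vof Qstar s) / 2 := by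
    refine Filter.limsup_le_of_le ?_ ?_
    · exact (Filter.isBoundedUnder_of ⟨-L, fun k => hlow k s a⟩ :
        IsBoundedUnder (· ≥ ·) atTop (fun k => Qseq k s a)).isCoboundedUnder_le
    · have hlt : Qstar s a < (Qstar s a + Vof Qstar s) / 2 := by linarith
      filter_upwards [hlim.eventually_lt_const hlt] with k hk
      exact (hup k s a).trans hk.le
  linarith
end

section
/- For the Advantage Learning iterates Q_{k+1} = T_AL Q_k starting from any Q_0 : S × A → ℝ, with V_k(s) = max_a Q_k(s,a), the action-gap sequence converges: for every state s and action a, V_k(s) − Q_k(s,a) → (1/(1−α)) · [V*(s) − Q*(s,a)] as k → ∞. -/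
open Filter Topology Finset

theorem Vof_aff_aux {S A : Type*} [Fintype A] [Nonempty A] (F G : S → A → ℝ) (s : S) (c d : ℝ)
    (hc : 0 ≤ c) (h : ∀ a, G s a = c * F s a + d) : Vof G s = c * Vof F s + d := by
  apply le_antisymm
  · refine ciSup_le fun a => ?_
    rw [h]
    have := mul_le_mul_of_nonneg_left (le_Vof_aux F s a) hc
    linarith
  · obtain ⟨a, ha⟩ := exists_eq_ciSup_of_finite (f := F s)
    have h1 := le_Vof_aux G s a
    have h2 : Vof F s = F s a := ha.symm
    rw [h2, ← h]
    exact h1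

theorem Vof_lip_aux {S A : Type*} [Fintype A] [Nonempty A] (F G : S → A → ℝ) (s : S) (ε : ℝ)
    (h : ∀ a, |F s a - G s a| ≤ ε) : |Vof F s - Vof G s| ≤ ε := by
  have h1 : Vof F s ≤ Vof G s + ε := ciSup_le fun a => by
    have := (abs_le.1 (h a)).2
    have := le_Vof_aux G s a
    linarith
  have h2 : Vof G s ≤ Vof F s + ε := ciSup_le fun a => by
    have := (abs_le.1 (h a)).1
    have := le_Vof_aux F s a
    linarith
  rw [abs_le]
  constructor <;> linarith

theorem exists_bd_aux {S A : Type*} [Fintype S] [Fintype A] (F : S → A → ℝ) :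
    ∃ C, 0 ≤ C ∧ ∀ s a, |F s a| ≤ C := by
  refine ⟨∑ s, ∑ a, |F s a|, by positivity, fun s a => ?_⟩
  calc |F s a| ≤ ∑ a, |F s a| :=
        Finset.single_le_sum (f := fun a => |F s a|) (fun _ _ => abs_nonneg _) (Finset.mem_univ a)
    _ ≤ _ := Finset.single_le_sum (f := fun s => ∑ a, |F s a|) (fun _ _ => by positivity)
        (Finset.mem_univ s)

theorem stmt_11
    {S A : Type*} [Fintype S] [Nonempty S] [Fintype A] [Nonempty A]
    (P : S → A → S → ℝ) (hP0 : ∀ s a s', 0 ≤ P s a s')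
    (hP1 : ∀ s a, ∑ s', P s a s' = 1)
    (r : S → A → ℝ) (γ : ℝ) (hγ0 : 0 ≤ γ) (hγ1 : γ < 1)
    (Qstar : S → A → ℝ) (hQstar : bellmanOp P r γ Qstar = Qstar)
    (α : ℝ) (hα0 : 0 ≤ α) (hα1 : α < 1)
    (Qseq : ℕ → S → A → ℝ)
    (hQseq : ∀ k, Qseq (k + 1) = alOp P r γ α (Qseq k))
 :
    ∀ (s : S) (a : A),
      Tendsto (fun k => Vof (Qseq k) s - Qseq k s a) atTop
        (𝓝 (1 / (1 - α) * (Vof Qstar s - Qstar s a))) := by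
  have hα : 0 < 1 - α := by linarith
  set b : ℝ := 1 / (1 - α) with hb
  have hb0 : 0 ≤ b := by positivity
  have hbα : b = 1 + α * b := by rw [hb]; field_simp; ring
  obtain ⟨W, hW0, hW⟩ : ∃ W : ℕ → S → ℝ, (∀ s, W 0 s = 0) ∧
      ∀ k s, W (k + 1) s = Vof (Qseq k) s + α * W k s :=
    ⟨fun k => Nat.rec (fun _ => 0) (fun k w s => Vof (Qseq k) s + α * w s) k,
      fun _ => rfl, fun _ _ => rfl⟩
  let G : ℕ → S → A → ℝ := fun k s a => Qseq k s a + α * W k s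
  let q : S → A → ℝ := fun s a => b * Qstar s a
  have hVG : ∀ k s, Vof (G k) s = Vof (Qseq k) s + α * W k s := fun k s => by
    have := Vof_aff_aux (Qseq k) (G k) s 1 (α * W k s) zero_le_one (fun a => by simp [G])
    simpa using this
  have hVq : ∀ s, Vof q s = b * Vof Qstar s := fun s => by
    have := Vof_aff_aux Qstar q s b 0 hb0 (fun a => by simp [q])
    simpa using this
  have hQ1 : ∀ k s a, Qseq (k + 1) s a =
      r s a + γ * ∑ s', P s a s' * Vof (Qseq k) s' - α * (Vof (Qseq k) s - Qseq k s a) :=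
    fun k s a => by rw [hQseq]; rfl
  have hWs : ∀ k s a, ∑ s', P s a s' * W (k + 1) s' =
      ∑ s', P s a s' * Vof (Qseq k) s' + α * ∑ s', P s a s' * W k s' := fun k s a => by
    rw [Finset.mul_sum, ← Finset.sum_add_distrib]
    refine Finset.sum_congr rfl fun s' _ => ?_
    rw [hW]; ring
  have hH : ∀ k s a, G k s a - γ * ∑ s', P s a s' * W k s' - b * r s a
      = α ^ k * (Qseq 0 s a - b * r s a) := by
    intro k s a
    induction k with
    | zero => simp [G, hW0]
    | succ k ih =>
      rw [pow_succ', mul_assoc, ← ih, hWs]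
      simp only [G]
      rw [hQ1, hW]
      linear_combination (-r s a) * hbα
  have hq : ∀ s a, q s a = b * r s a + γ * ∑ s', P s a s' * Vof q s' := by
    intro s a
    have h1 : Qstar s a = r s a + γ * ∑ s', P s a s' * Vof Qstar s' := by
      conv_lhs => rw [← hQstar]
      rfl
    have h2 : ∑ s', P s a s' * Vof q s' = b * ∑ s', P s a s' * Vof Qstar s' := by
      rw [Finset.mul_sum]
      refine Finset.sum_congr rfl fun s' _ => ?_
      rw [hVq]; ring
    rw [h2]
    simp only [q]
    linear_combination b * h1
  obtain ⟨C, hC0, hC⟩ := exists_bd_aux (fun s a => Qseq 0 s a - b * r s a)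
  obtain ⟨D, hD0, hD⟩ := exists_bd_aux (fun s a => G 0 s a - q s a)
  obtain ⟨ρ, hρ, hρ1⟩ := exists_between (max_lt hγ1 hα1)
  have hγρ : γ < ρ := (le_max_left _ _).trans_lt hρ
  have hαρ : α < ρ := (le_max_right _ _).trans_lt hρ
  have hρ0 : 0 ≤ ρ := hγ0.trans hγρ.le
  have hργ : 0 < ρ - γ := by linarith
  set K : ℝ := D + C / (ρ - γ) with hK
  have hKC : C ≤ K * (ρ - γ) := by
    have : K * (ρ - γ) = D * (ρ - γ) + C := by rw [hK]; field_simp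
    have : 0 ≤ D * (ρ - γ) := by positivity
    linarith
  have key : ∀ k s a, |G k s a - q s a| ≤ K * ρ ^ k := by
    intro k
    induction k with
    | zero =>
      intro s a
      have h1 := hD s a
      have : 0 ≤ C / (ρ - γ) := by positivity
      simp only [pow_zero, mul_one]
      linarith
    | succ k ih =>
      intro s a
      have hV : ∀ s', |W (k + 1) s' - Vof q s'| ≤ K * ρ ^ k := fun s' => by
        rw [hW, ← hVG]
        exact Vof_lip_aux _ _ _ _ (ih s')
      have hs : |∑ s', P s a s' * (W (k + 1) s' - Vof q s')| ≤ K * ρ ^ k := by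
        calc _ ≤ ∑ s', |P s a s' * (W (k + 1) s' - Vof q s')| := Finset.abs_sum_le_sum_abs _ _
          _ ≤ ∑ s', P s a s' * (K * ρ ^ k) := by
            refine Finset.sum_le_sum fun s' _ => ?_
            rw [abs_mul, abs_of_nonneg (hP0 s a s')]
            exact mul_le_mul_of_nonneg_left (hV s') (hP0 s a s')
          _ = K * ρ ^ k := by rw [← Finset.sum_mul, hP1, one_mul]
      have he : G (k + 1) s a - q s a = γ * ∑ s', P s a s' * (W (k + 1) s' - Vof q s')
          + α ^ (k + 1) * (Qseq 0 s a - b * r s a) := by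
        simp only [mul_sub, Finset.sum_sub_distrib]
        linear_combination hH (k + 1) s a - hq s a
      have hα' : α ^ (k + 1) ≤ ρ ^ k := by
        calc α ^ (k + 1) ≤ α ^ k := pow_le_pow_of_le_one hα0 hα1.le (Nat.le_succ k)
          _ ≤ ρ ^ k := pow_le_pow_left₀ hα0 hαρ.le k
      rw [he]
      calc _ ≤ |γ * ∑ s', P s a s' * (W (k + 1) s' - Vof q s')|
            + |α ^ (k + 1) * (Qseq 0 s a - b * r s a)| := abs_add_le _ _
        _ ≤ γ * (K * ρ ^ k) + ρ ^ k * C := by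
          rw [abs_mul, abs_mul, abs_of_nonneg hγ0, abs_of_nonneg (pow_nonneg hα0 _)]
          exact add_le_add (mul_le_mul_of_nonneg_left hs hγ0)
            (mul_le_mul hα' (hC s a) (abs_nonneg _) (pow_nonneg hρ0 _))
        _ ≤ K * ρ ^ (k + 1) := by
          have := mul_le_mul_of_nonneg_left hKC (pow_nonneg hρ0 k)
          rw [pow_succ]
          linarith
  intro s a
  have hlim : Tendsto (fun k => 2 * (K * ρ ^ k)) atTop (𝓝 0) := by
    have := ((tendsto_pow_atTop_nhds_zero_of_lt_one hρ0 hρ1).const_mul K).const_mul 2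
    simpa using this
  rw [tendsto_iff_dist_tendsto_zero]
  refine squeeze_zero (fun _ => dist_nonneg) (fun k => ?_) hlim
  rw [Real.dist_eq]
  have h1 := Vof_lip_aux (G k) q s _ (key k s)
  have h2 := key k s a
  have h3 : Vof (Qseq k) s - Qseq k s a - b * (Vof Qstar s - Qstar s a)
      = (Vof (G k) s - Vof q s) - (G k s a - q s a) := by
    rw [hVG, hVq]; simp only [G, q]; ring
  rw [h3]
  exact (abs_sub _ _).trans (by linarith)
end
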